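/- For a holonomic left D_n-module M, the length of M as a left D_n-module is finite and satisfies length M ≤ mult M. -/

import Mathlib

open Polynomial MvPolynomial

/-- Defining relations of the `n`-th Weyl algebra over `K`:
generators `Sum.inl i` are the multiplication operators `x_i`, generators
`Sum.inr i` are the partial derivations `∂_i`. -/
inductive WeylRel (K : Type) [Field K] (n : ℕ) :
    FreeAlgebra K (Fin n ⊕ Fin n) → FreeAlgebra K (Fin n ⊕ Fin n) → Prop
  | xx (i j : Fin n) : WeylRel K n
      (FreeAlgebra.ι K (Sum.inl i) * FreeAlgebra.ι K (Sum.inl j))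
      (FreeAlgebra.ι K (Sum.inl j) * FreeAlgebra.ι K (Sum.inl i))
  | dd (i j : Fin n) : WeylRel K n
      (FreeAlgebra.ι K (Sum.inr i) * FreeAlgebra.ι K (Sum.inr j))
      (FreeAlgebra.ι K (Sum.inr j) * FreeAlgebra.ι K (Sum.inr i))
  | dx (i j : Fin n) : WeylRel K n
      (FreeAlgebra.ι K (Sum.inr i) * FreeAlgebra.ι K (Sum.inl j))
      (FreeAlgebra.ι K (Sum.inl j) * FreeAlgebra.ι K (Sum.inr i)
        + if i = j then 1 else 0)

/-- The `n`-th Weyl algebra `D_n` over `K`. -/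
abbrev Weyl (K : Type) [Field K] (n : ℕ) : Type := RingQuot (WeylRel K n)

/-- The operator `x_i ∈ D_n`. -/
noncomputable def wX (K : Type) [Field K] (n : ℕ) (i : Fin n) : Weyl K n :=
  RingQuot.mkAlgHom K (WeylRel K n) (FreeAlgebra.ι K (Sum.inl i))

/-- The operator `∂_i ∈ D_n`. -/
noncomputable def wD (K : Type) [Field K] (n : ℕ) (i : Fin n) : Weyl K n :=
  RingQuot.mkAlgHom K (WeylRel K n) (FreeAlgebra.ι K (Sum.inr i))

/-- The Bernstein filtration on the Weyl algebra: `F_k(D_n)` is spanned by the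
monomials `x^α ∂^β` with `|α| + |β| ≤ k`. -/
noncomputable def bernsteinF (K : Type) [Field K] (n : ℕ) (k : ℤ) :
    Submodule K (Weyl K n) :=
  Submodule.span K {w | ∃ α β : Fin n → ℕ,
    ((∑ i, α i : ℕ) + (∑ i, β i : ℕ) : ℤ) ≤ k ∧
    w = ((List.finRange n).map fun i => wX K n i ^ α i).prod *
        ((List.finRange n).map fun i => wD K n i ^ β i).prod}

/-- A good Bernstein filtration on a left `D_n`-module `M`. -/
structure GoodFiltration (K : Type) [Field K] (n : ℕ) (M : Type)
    [AddCommGroup M] [Module K M] [Module (Weyl K n) M]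
    [IsScalarTower K (Weyl K n) M] (F : ℤ → Submodule K M) : Prop where
  mono : ∀ k, F k ≤ F (k + 1)
  exhaustive : ∀ m : M, ∃ k, m ∈ F k
  compat : ∀ j k : ℤ, ∀ w ∈ bernsteinF K n j, ∀ m ∈ F k, w • m ∈ F (j + k)
  bddBelow : ∃ k₀ : ℤ, ∀ k < k₀, F k = ⊥
  finiteDim : ∀ k, FiniteDimensional K (F k)
  good : ∃ k₁ : ℤ, ∀ k ≥ k₁, ∀ j ≥ (0 : ℤ),
    F (j + k) ≤ Submodule.span K
      {m | ∃ w ∈ bernsteinF K n j, ∃ v ∈ F k, m = w • v}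

/-- `HasMult K n M m` : the holonomic module `M` admits a good Bernstein filtration
whose Hilbert polynomial `h` satisfies `(deg h)! · (leading coeff of h) = m`; i.e.
the multiplicity of `M` is `m`. -/
def HasMult (K : Type) [Field K] (n : ℕ) (M : Type)
    [AddCommGroup M] [Module K M] [Module (Weyl K n) M]
    [IsScalarTower K (Weyl K n) M] (m : ℚ) : Prop :=
  ∃ F : ℤ → Submodule K M, GoodFiltration K n M F ∧
    ∃ h : Polynomial ℚ,
      (∃ N : ℤ, ∀ k ≥ N, (Module.finrank K (F k) : ℚ) = h.eval (k : ℚ)) ∧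
      m = (Nat.factorial h.natDegree : ℚ) * h.leadingCoeff

/-- `M` is a holonomic left `D_n`-module. -/
def IsHolonomic (K : Type) [Field K] (n : ℕ) (M : Type)
    [AddCommGroup M] [Module K M] [Module (Weyl K n) M]
    [IsScalarTower K (Weyl K n) M] : Prop :=
  Subsingleton M ∨
  ∃ F : ℤ → Submodule K M, GoodFiltration K n M F ∧
    ∃ h : Polynomial ℚ,
      (∃ N : ℤ, ∀ k ≥ N, (Module.finrank K (F k) : ℚ) = h.eval (k : ℚ)) ∧
      h.natDegree = n

/-- The length of a module: the Krull dimension of its lattice of submodules. -/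
noncomputable def mlength (A : Type) [Ring A] (M : Type) [AddCommGroup M]
    [Module A M] : WithBot ℕ∞ :=
  Order.krullDim (Submodule A M)

section CommutatorCalculus

variable {A E : Type*} [CommRing A] [Ring E] [Algebra A E]

/-- If `[d, x] = 1`, then the commutator of `d` with `P(x)` is the derivative of `P` at `x`. -/
lemma mul_aeval_of_comm_one {x d : E} (h : d * x = x * d + 1) (P : A[X]) :
    d * aeval x P = aeval x P * d + aeval x (derivative P) := by
  induction P using Polynomial.induction_on' with
  | add p q hp hq => simp only [map_add, mul_add, add_mul, hp, hq]; abel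
  | monomial k a =>
    have key : ∀ k : ℕ, d * x ^ k = x ^ k * d + (k : A) • x ^ (k - 1) := by
      intro k
      induction k with
      | zero => simp
      | succ k ih =>
        rw [pow_succ, ← mul_assoc, ih, add_mul, mul_assoc, h, mul_add, mul_one, ← mul_assoc,
          Nat.add_sub_cancel, smul_mul_assoc, add_assoc]
        congr 1
        rcases k with _ | k
        · simp
        · rw [Nat.add_sub_cancel, ← pow_succ, Nat.cast_succ (k + 1), add_smul _ (1 : A), one_smul,
            add_comm]
    rw [Polynomial.aeval_monomial, derivative_monomial, Polynomial.aeval_monomial, ← Algebra.smul_def,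
      ← Algebra.smul_def, mul_smul_comm, key, smul_add, smul_smul, smul_mul_assoc]

lemma pow_mul_of_comm {d p p' : E} (h : d * p = p * d + p') (hc : Commute p p') (k : ℕ) :
    p ^ (k + 1) * d = d * p ^ (k + 1) - (k + 1 : A) • (p' * p ^ k) := by
  induction k with
  | zero => simp [h]
  | succ k ih =>
    have e : d * p ^ (k + 1 + 1) = p * (d * p ^ (k + 1)) + p' * p ^ (k + 1) := by
      rw [pow_succ' p (k + 1), ← mul_assoc, h, add_mul, mul_assoc]
    rw [e, pow_succ' p (k + 1), mul_assoc, ih, mul_sub, mul_smul_comm, ← mul_assoc p p',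
      hc.eq, mul_assoc p', ← pow_succ' p k]
    rw [Nat.cast_succ, add_smul ((k : A) + 1) (1 : A), one_smul]
    abel

end CommutatorCalculus

section FreeVectors

variable {A N : Type*} [CommRing A] [AddCommGroup N] [Module A N]

lemma pow_apply_pow_of_comm {d p p' : Module.End A N} (h : d * p = p * d + p')
    (hc : Commute p p') {w : N} (hw : p w = 0) (j : ℕ) :
    (p ^ (j + 1)) ((d ^ j) w) = 0 ∧
      (p ^ j) ((d ^ j) w) = ((-1) ^ j * (j.factorial : A)) • (p' ^ j) w := by
  induction j with
  | zero => simpa using hw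
  | succ j ih =>
    have step : ∀ k : ℕ, (p ^ (k + 1)) ((d ^ (j + 1)) w) =
        d ((p ^ (k + 1)) ((d ^ j) w)) - (k + 1 : A) • p' ((p ^ k) ((d ^ j) w)) := by
      intro k
      have := LinearMap.congr_fun (pow_mul_of_comm (A := A) h hc k) ((d ^ j) w)
      rw [pow_succ' d]
      simpa using this
    constructor
    · rw [step, ih.1, map_zero, smul_zero, sub_zero, pow_succ' p, Module.End.mul_apply, ih.1,
        map_zero, map_zero]
    · rw [step, ih.1, map_zero, zero_sub, ih.2, map_smul, smul_smul, ← neg_smul,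
        ← Module.End.mul_apply, ← pow_succ']
      congr 1
      rw [Nat.factorial_succ, pow_succ]
      push_cast
      ring

/-- Given operators with `[d, x] = 1` and a torsion-free vector over a domain `A` of characteristic
zero, some vector is torsion-free over `A[x]` or over `A[d]`. -/
lemma exists_torsionFree_adjoin [IsDomain A] [CharZero A] {x d : Module.End A N}
    (h : d * x = x * d + 1) {u : N} (hu : ∀ a : A, a • u = 0 → a = 0) :
    ∃ y : Module.End A N, (y = x ∨ y = d) ∧
      ∃ v : N, ∀ Q : A[X], aeval y Q v = 0 → Q = 0 := by
  classical
  by_cases hx : ∀ Q : A[X], aeval x Q u = 0 → Q = 0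
  · exact ⟨x, .inl rfl, u, hx⟩
  push Not at hx
  obtain ⟨Q₀, hQ₀, hQ₀'⟩ := hx
  have hex : ∃ k : ℕ, ∃ P : A[X], P ≠ 0 ∧ P.natDegree = k ∧ ∃ w : N,
      (∀ a : A, a • w = 0 → a = 0) ∧ aeval x P w = 0 :=
    ⟨_, Q₀, hQ₀', rfl, u, hu, hQ₀⟩
  obtain ⟨P, hP, hPk, w, hw, hPw⟩ := Nat.find_spec hex
  have hmin : ∀ R : A[X], R ≠ 0 → R.natDegree < P.natDegree → ∀ w : N,
      (∀ a : A, a • w = 0 → a = 0) → aeval x R w ≠ 0 := by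
    intro R hR hRd w hw hRw
    exact Nat.find_min hex (hPk ▸ hRd) ⟨R, hR, rfl, w, hw, hRw⟩
  have hdeg : P.natDegree ≠ 0 := by
    intro h0
    rw [natDegree_eq_zero] at h0
    obtain ⟨a, rfl⟩ := h0
    rw [Polynomial.aeval_C, Module.algebraMap_end_apply] at hPw
    exact hP (by rw [hw a hPw, Polynomial.C_0])
  have hder : derivative P ≠ 0 := fun h0 => hdeg (Polynomial.derivative_eq_zero.1 h0)
  have hstep : ∀ w : N, (∀ a : A, a • w = 0 → a = 0) →
      ∀ a : A, a • aeval x (derivative P) w = 0 → a = 0 := by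
    intro w hw a ha
    by_contra hane
    refine hmin (Polynomial.C a * derivative P) (mul_ne_zero (by simpa using hane) hder) ?_ w hw ?_
    · exact (natDegree_C_mul_le _ _).trans_lt (natDegree_derivative_lt hdeg)
    · simpa using ha
  have hpow : ∀ (k : ℕ) (a : A), a • (aeval x (derivative P) ^ k) w = 0 → a = 0 := by
    intro k
    induction k with
    | zero => simpa using hw
    | succ k ih =>
      rw [pow_succ']
      exact hstep _ ih
  have hcomm := mul_aeval_of_comm_one h P
  have hc : Commute (aeval x P) (aeval x (derivative P)) := by
    rw [Commute, SemiconjBy, ← map_mul, ← map_mul, mul_comm]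
  have hval := pow_apply_pow_of_comm hcomm hc hPw
  have hvan : ∀ j k : ℕ, j < k → (aeval x P ^ k) ((d ^ j) w) = 0 := by
    intro j k hjk
    obtain ⟨i, rfl⟩ := Nat.exists_eq_add_of_lt hjk
    rw [show j + i + 1 = i + (j + 1) by ring, pow_add, Module.End.mul_apply, (hval j).1, map_zero]
  refine ⟨d, .inr rfl, w, fun Q hQ => ?_⟩
  by_contra hQ0
  have h0 : (aeval x P ^ Q.natDegree) (aeval d Q w) = 0 := by rw [hQ, map_zero]
  rw [aeval_eq_sum_range (p := Q), LinearMap.sum_apply, map_sum, Finset.sum_range_succ,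
    Finset.sum_eq_zero, zero_add, LinearMap.smul_apply, map_smul, (hval _).2, smul_smul] at h0
  · have := hpow _ _ h0
    simp [hQ0, Nat.factorial_ne_zero] at this
  · intro j hj
    rw [LinearMap.smul_apply, map_smul, hvan _ _ (Finset.mem_range.1 hj), smul_zero]

end FreeVectors

/-- A nonzero torsion-free vector for `m` pairs of canonical operators gives rise to a free family
indexed by `ℕ^m`, obtained by applying monomials in `m` of the `2 m` operators. -/
lemma exists_linearIndependent_of_canonicalPairs {N : Type*} [AddCommGroup N] (G : ℕ → Set N)
    (hG : ∀ v, ∃ k, v ∈ G k) (m : ℕ) :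
    ∀ (A : Type) [CommRing A] [IsDomain A] [CharZero A] [Module A N]
      (x d : Fin m → Module.End A N)
      (_ : ∀ i j, Commute (x i) (x j)) (_ : ∀ i j, Commute (d i) (d j))
      (_ : ∀ i j, d i * x j = x j * d i + if i = j then 1 else 0)
      (_ : ∀ i k, ∀ v ∈ G k, x i v ∈ G (k + 1)) (_ : ∀ i k, ∀ v ∈ G k, d i v ∈ G (k + 1))
      (u : N) (_ : ∀ a : A, a • u = 0 → a = 0),
      ∃ e : (Fin m → ℕ) → N, LinearIndependent A e ∧ ∃ c, ∀ α, e α ∈ G (c + ∑ i, α i) := by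
  induction m with
  | zero =>
    intro A _ _ _ _ x d _ _ _ _ _ u hu
    obtain ⟨c, hc⟩ := hG u
    refine ⟨fun _ => u, ?_, c, fun α => by simpa using hc⟩
    rw [Fintype.linearIndependent_iff]
    intro g hg i
    rw [Unique.eq_default i]
    exact hu _ (by simpa using hg)
  | succ m ih =>
    intro A _ _ _ _ x d hxx hdd hdx hGx hGd u hu
    obtain ⟨y, hy, v, hv⟩ := exists_torsionFree_adjoin (by simpa using hdx 0 0) hu
    let _ : Module A[X] N := Module.compHom N (aeval (R := A) y).toRingHom
    have smul_def : ∀ (Q : A[X]) (w : N), Q • w = aeval y Q w := fun _ _ => rfl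
    have : IsScalarTower A A[X] N := ⟨fun a Q w => by simp [smul_def]⟩
    have hxy : ∀ i : Fin m, Commute (x i.succ) y := by
      intro i
      rcases hy with rfl | rfl
      · exact hxx _ _
      · have := hdx 0 i.succ
        rw [if_neg (Fin.succ_ne_zero i).symm, add_zero] at this
        exact this.symm
    have hdy : ∀ i : Fin m, Commute (d i.succ) y := by
      intro i
      rcases hy with rfl | rfl
      · have := hdx i.succ 0
        rwa [if_neg (Fin.succ_ne_zero i), add_zero] at this
      · exact hdd _ _
    have hcomm : ∀ {z : Module.End A N}, Commute z y → ∀ (Q : A[X]) (w : N),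
        z (Q • w) = Q • z w := by
      intro z hz Q w
      have hQ : Commute z (aeval y Q) := by
        induction Q using Polynomial.induction_on' with
        | add p q hp hq => rw [map_add]; exact hp.add_right hq
        | monomial k a =>
          rw [Polynomial.aeval_monomial]
          exact (Algebra.commute_algebraMap_right a z).mul_right (hz.pow_right k)
      exact LinearMap.congr_fun hQ.eq w
    let lift (z : Module.End A N) (hz : Commute z y) : Module.End A[X] N :=
      { toFun := z, map_add' := map_add z, map_smul' := hcomm hz }
    obtain ⟨e, he, c, hc⟩ := ih A[X] (fun i => lift (x i.succ) (hxy i))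
      (fun i => lift (d i.succ) (hdy i))
      (fun i j => LinearMap.ext fun w => LinearMap.congr_fun (hxx i.succ j.succ).eq w)
      (fun i j => LinearMap.ext fun w => LinearMap.congr_fun (hdd i.succ j.succ).eq w)
      (fun i j => LinearMap.ext fun w => by
        have := LinearMap.congr_fun (hdx i.succ j.succ) w
        simp only [Fin.succ_inj] at this
        by_cases hij : i = j
        · rw [if_pos hij] at this ⊢
          exact this
        · rw [if_neg hij] at this ⊢
          exact this)
      (fun i => hGx i.succ) (fun i => hGd i.succ) v hv
    have hGy : ∀ k, ∀ w ∈ G k, y w ∈ G (k + 1) := by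
      rcases hy with rfl | rfl
      · exact hGx 0
      · exact hGd 0
    have hX : LinearIndependent A (fun k : ℕ => (X : A[X]) ^ k) := by
      simpa [Polynomial.coe_basisMonomials, Polynomial.X_pow_eq_monomial] using (Polynomial.basisMonomials A).linearIndependent
    refine ⟨fun α => (X : A[X]) ^ α 0 • e (Fin.tail α), ?_, c, fun α => ?_⟩
    · refine (linearIndependent_smul hX he).comp (fun α : Fin (m + 1) → ℕ => (α 0, Fin.tail α)) ?_
      intro α β hαβ
      rw [← Fin.cons_self_tail α, ← Fin.cons_self_tail β]
      simp only [Prod.mk.injEq] at hαβ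
      rw [hαβ.1, hαβ.2]
    · have hpow : ∀ (j k : ℕ) (w : N), w ∈ G k → (X : A[X]) ^ j • w ∈ G (k + j) := by
        intro j
        induction j with
        | zero => intro k w hw; simpa using hw
        | succ j ihj =>
          intro k w hw
          have := hGy _ _ (ihj k w hw)
          rw [pow_succ', mul_smul]
          rw [show k + (j + 1) = k + j + 1 by ring]
          simpa [smul_def] using this
      have := hpow (α 0) _ _ (hc (Fin.tail α))
      rw [Fin.sum_univ_succ, add_left_comm, add_comm]
      exact this

section WeylAlgebra

variable (K : Type) [Field K] (n : ℕ)

lemma wX_commute (i j : Fin n) : Commute (wX K n i) (wX K n j) := by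
  have := RingQuot.mkAlgHom_rel K (WeylRel.xx (K := K) i j)
  rwa [map_mul, map_mul] at this

lemma wD_commute (i j : Fin n) : Commute (wD K n i) (wD K n j) := by
  have := RingQuot.mkAlgHom_rel K (WeylRel.dd (K := K) i j)
  rwa [map_mul, map_mul] at this

lemma wD_mul_wX (i j : Fin n) :
    wD K n i * wX K n j = wX K n j * wD K n i + if i = j then 1 else 0 := by
  have := RingQuot.mkAlgHom_rel K (WeylRel.dx (K := K) i j)
  rw [map_mul, map_add, map_mul, apply_ite (RingQuot.mkAlgHom K (WeylRel K n)), map_one,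
    map_zero] at this
  exact this

lemma prod_map_finRange_pow_single {R : Type*} [Monoid R] (f : Fin n → R) (i : Fin n) :
    ((List.finRange n).map fun j => f j ^ (Pi.single i 1 : Fin n → ℕ) j).prod = f i := by
  rw [List.prod_map_eq_pow_single i _ fun j hj _ => by simp [hj],
    List.count_eq_one_of_mem (List.nodup_finRange n) (List.mem_finRange i)]
  simp

lemma wX_mem_bernsteinF (i : Fin n) : wX K n i ∈ bernsteinF K n 1 :=
  Submodule.subset_span ⟨Pi.single i 1, 0, by simp, by
    rw [prod_map_finRange_pow_single]; simp⟩

lemma wD_mem_bernsteinF (i : Fin n) : wD K n i ∈ bernsteinF K n 1 :=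
  Submodule.subset_span ⟨0, Pi.single i 1, by simp, by
    rw [prod_map_finRange_pow_single]; simp⟩

end WeylAlgebra

section Filtrations

variable {K : Type} [Field K] {n : ℕ} {M : Type} [AddCommGroup M] [Module K M]
  [Module (Weyl K n) M] [IsScalarTower K (Weyl K n) M] {F : ℤ → Submodule K M}

/-- A nonzero `D_n`-module with an exhaustive filtration compatible with the operators `x_i`, `∂_i`
contains a linearly independent family indexed by `ℕ^n` adapted to the filtration. -/
lemma exists_linearIndependent_of_nontrivial [CharZero K] [Nontrivial M] (G : ℕ → Set M)
    (hG : ∀ v, ∃ k, v ∈ G k) (hGx : ∀ i k, ∀ v ∈ G k, wX K n i • v ∈ G (k + 1))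
    (hGd : ∀ i k, ∀ v ∈ G k, wD K n i • v ∈ G (k + 1)) :
    ∃ e : (Fin n → ℕ) → M, LinearIndependent K e ∧ ∃ c, ∀ α, e α ∈ G (c + ∑ i, α i) := by
  obtain ⟨u, hu⟩ := exists_ne (0 : M)
  refine exists_linearIndependent_of_canonicalPairs G hG n K
    (fun i => Algebra.lsmul K K M (wX K n i)) (fun i => Algebra.lsmul K K M (wD K n i))
    (fun i j => (wX_commute K n i j).map _) (fun i j => (wD_commute K n i j).map _)
    (fun i j => ?_) hGx hGd u (fun a ha => (smul_eq_zero.1 ha).resolve_right hu)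
  rw [← map_mul, ← map_mul, wD_mul_wX, map_add, apply_ite (Algebra.lsmul K K M), map_one, map_zero]

lemma choose_le_finrank_of_linearIndependent {V : Type*} [AddCommGroup V] [Module K V]
    {e : (Fin n → ℕ) → V} (he : LinearIndependent K e) {k : ℕ} {W : Submodule K V}
    [FiniteDimensional K W] (hW : ∀ α : Fin n → ℕ, ∑ i, α i ≤ k → e α ∈ W) :
    (k + n).choose n ≤ Module.finrank K W := by
  let S := (Finset.univ : Finset (Fin (n + 1))).finsuppAntidiag k
  have hsum : ∀ f ∈ S, f 0 + ∑ i : Fin n, f i.succ = k := by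
    intro f hf
    rw [← Fin.sum_univ_succ]
    exact (Finset.mem_finsuppAntidiag.1 hf).1
  let t : S → Fin n → ℕ := fun f i => f.1 i.succ
  have ht : Function.Injective t := by
    rintro ⟨f, hf⟩ ⟨g, hg⟩ hfg
    have hs : ∀ i : Fin n, f i.succ = g i.succ := fun i => congrFun hfg i
    have h1 := hsum f hf
    have h2 := hsum g hg
    simp only [hs] at h1
    ext i
    refine Fin.cases ?_ hs i
    show f 0 = g 0
    omega
  have hcard : Fintype.card S = (k + n).choose n := by
    rw [Fintype.card_coe, Finset.card_finsuppAntidiag_nat_eq_choose, Finset.card_univ,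
      Fintype.card_fin, ← Nat.choose_symm_add, add_comm k n, Nat.add_right_comm, Nat.add_sub_cancel]
  rw [← hcard, ← finrank_span_eq_card (he.comp t ht)]
  refine Submodule.finrank_mono (Submodule.span_le.2 ?_)
  rintro _ ⟨f, rfl⟩
  exact hW _ ((Nat.le_add_left _ _).trans (hsum f.1 f.2).le)

/-- In a strict inclusion of submodules the filtered dimension grows by at least that of a
polynomial ring in `n` variables. -/
lemma GoodFiltration.exists_choose_le_of_lt [CharZero K] (hF : GoodFiltration K n M F)
    {P Q : Submodule (Weyl K n) M} (hPQ : P < Q) :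
    ∃ c : ℕ, ∀ k : ℕ,
      Module.finrank K ↥(F (k + c : ℕ) ⊓ P.restrictScalars K) + (k + n).choose n ≤
        Module.finrank K ↥(F (k + c : ℕ) ⊓ Q.restrictScalars K) := by
  have hmono : Monotone F := monotone_int_of_le_succ hF.mono
  have hcompat : ∀ w ∈ bernsteinF K n 1, ∀ (k : ℕ), ∀ v ∈ F k, w • v ∈ F (k + 1 : ℕ) := by
    intro w hw k v hv
    have := hF.compat 1 k w hw v hv
    rwa [add_comm, ← Nat.cast_succ] at this
  let N : Submodule (Weyl K n) (M ⧸ P) := Q.map P.mkQ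
  let G : ℕ → Set N := fun k => {v | ∃ q ∈ Q, q ∈ F k ∧ P.mkQ q = v}
  have hGsmul : ∀ w ∈ bernsteinF K n 1, ∀ k, ∀ v ∈ G k, w • v ∈ G (k + 1) := by
    rintro w hw k v ⟨q, hqQ, hqF, hqv⟩
    exact ⟨w • q, Q.smul_mem _ hqQ, hcompat w hw k q hqF, by rw [map_smul, hqv]; rfl⟩
  have hG : ∀ v, ∃ k, v ∈ G k := by
    rintro ⟨_, q, hq, rfl⟩
    obtain ⟨k, hk⟩ := hF.exhaustive q
    exact ⟨k.toNat, q, hq, hmono (Int.self_le_toNat k) hk, rfl⟩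
  have : Nontrivial N := by
    obtain ⟨q, hq, hqP⟩ := Set.exists_of_ssubset hPQ
    refine ⟨⟨⟨P.mkQ q, q, hq, rfl⟩, 0, fun h => hqP ?_⟩⟩
    simpa using congrArg Subtype.val h
  obtain ⟨e, he, c, hc⟩ := exists_linearIndependent_of_nontrivial G hG
    (fun i => hGsmul _ (wX_mem_bernsteinF K n i)) (fun i => hGsmul _ (wD_mem_bernsteinF K n i))
  refine ⟨c, fun k => ?_⟩
  set W := F (k + c : ℕ) ⊓ Q.restrictScalars K
  have := hF.finiteDim (k + c : ℕ)
  have : FiniteDimensional K W := Submodule.finiteDimensional_inf_left _ _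
  let φ : W →ₗ[K] M ⧸ P := (P.mkQ.restrictScalars K) ∘ₗ W.subtype
  have hker : LinearMap.ker φ = (F (k + c : ℕ) ⊓ P.restrictScalars K).submoduleOf W := by
    ext x
    have hx : (x : M) ∈ F (k + c : ℕ) := x.2.1
    simpa [φ, Submodule.submoduleOf] using fun _ => by simpa using hx
  have hle : F (k + c : ℕ) ⊓ P.restrictScalars K ≤ W := inf_le_inf_left _ hPQ.le
  rw [← LinearMap.finrank_range_add_finrank_ker φ, hker,
    (Submodule.submoduleOfEquivOfLe hle).finrank_eq, add_comm]
  refine Nat.add_le_add_right (choose_le_finrank_of_linearIndependent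
    (he.map' (N.subtype.restrictScalars K) ?_) ?_) _
  · rw [LinearMap.ker_eq_bot]
    exact N.injective_subtype
  · intro α hα
    obtain ⟨q, hqQ, hqF, hq⟩ := hc α
    exact ⟨⟨q, hmono (Int.ofNat_le.2 (by omega)) hqF, hqQ⟩, hq⟩

lemma GoodFiltration.exists_length_mul_choose_le [CharZero K] (hF : GoodFiltration K n M F)
    (s : LTSeries (Submodule (Weyl K n) M)) :
    ∃ c : ℕ, ∀ k : ℕ, s.length * (k + n).choose n ≤ Module.finrank K (F (k + c : ℕ)) := by
  have hmono : Monotone F := monotone_int_of_le_succ hF.mono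
  have hfin := hF.finiteDim
  have key : ∀ i (hi : i < s.length + 1), ∃ c : ℕ, ∀ k : ℕ, i * (k + n).choose n ≤
      Module.finrank K ↥(F (k + c : ℕ) ⊓ (s ⟨i, hi⟩).restrictScalars K) := by
    intro i
    induction i with
    | zero => simp
    | succ i ih =>
      intro hi
      obtain ⟨c₁, hc₁⟩ := ih (by omega)
      obtain ⟨c₂, hc₂⟩ := hF.exists_choose_le_of_lt (s.step ⟨i, by omega⟩)
      refine ⟨c₁ + c₂, fun k => ?_⟩
      have h₂ := hc₂ (k + c₁)
      rw [add_assoc] at h₂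
      refine le_trans ?_ h₂
      rw [add_mul, one_mul]
      refine Nat.add_le_add ((hc₁ k).trans (Submodule.finrank_mono
        (inf_le_inf_right _ (hmono ?_)))) (Nat.choose_le_choose _ (by omega))
      push_cast
      omega
  obtain ⟨c, hc⟩ := key s.length (Nat.lt_succ_self _)
  exact ⟨c, fun k => (hc k).trans (Submodule.finrank_mono inf_le_left)⟩

/-- A good filtration is, up to a shift, contained in any other good filtration. -/
lemma GoodFiltration.exists_le_shift {F' : ℤ → Submodule K M} (hF : GoodFiltration K n M F)
    (hF' : GoodFiltration K n M F') : ∃ c N : ℤ, ∀ k ≥ N, F' k ≤ F (k + c) := by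
  have hmono : Monotone F := monotone_int_of_le_succ hF.mono
  obtain ⟨k₁, hk₁⟩ := hF'.good
  have := hF'.finiteDim k₁
  obtain ⟨t, ht⟩ : (F' k₁).FG := Module.Finite.iff_fg.1 this
  obtain ⟨b, hb⟩ : ∃ b : ℤ, F' k₁ ≤ F b := by
    choose g hg using hF.exhaustive
    obtain ⟨b, hb⟩ := (t.image g).bddAbove
    refine ⟨b, ht ▸ Submodule.span_le.2 fun x hx => hmono (hb ?_) (hg x)⟩
    exact Finset.mem_coe.2 (Finset.mem_image_of_mem g hx)
  refine ⟨b - k₁, k₁, fun k hk => ?_⟩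
  have h := hk₁ k₁ le_rfl (k - k₁) (by omega)
  rw [sub_add_cancel] at h
  refine h.trans (Submodule.span_le.2 ?_)
  rintro _ ⟨w, hw, v, hv, rfl⟩
  have := hF.compat (k - k₁) b w hw v (hb hv)
  rwa [show k - k₁ + b = k + (b - k₁) by ring] at this

end Filtrations

section HilbertPolynomials

lemma Polynomial.leadingCoeff_nonneg_of_eval_natCast_nonneg {q : ℚ[X]} {N : ℕ}
    (h : ∀ k : ℕ, N ≤ k → 0 ≤ q.eval (k : ℚ)) : 0 ≤ q.leadingCoeff := by
  by_contra! hneg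
  by_cases hd : 0 < q.degree
  · have := (q.tendsto_atBot_of_leadingCoeff_nonpos hd hneg.le).comp
      (tendsto_natCast_atTop_atTop (R := ℚ))
    obtain ⟨k, hk, hkN⟩ := ((this.eventually_lt_atBot 0).and (Filter.eventually_ge_atTop N)).exists
    exact (h k hkN).not_gt hk
  · rw [not_lt, degree_le_zero_iff] at hd
    have := h N le_rfl
    rw [hd, eval_C] at this
    rw [hd, leadingCoeff_C] at hneg
    exact this.not_gt hneg

lemma Polynomial.coeff_nonneg_of_eval_natCast_nonneg {q : ℚ[X]} {N n : ℕ} (hq : q.natDegree ≤ n)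
    (h : ∀ k : ℕ, N ≤ k → 0 ≤ q.eval (k : ℚ)) : 0 ≤ q.coeff n := by
  rcases hq.lt_or_eq with hlt | rfl
  · rw [coeff_eq_zero_of_natDegree_lt hlt]
  · exact leadingCoeff_nonneg_of_eval_natCast_nonneg h

lemma Polynomial.natDegree_le_of_eval_natCast_le {p q : ℚ[X]} {N : ℕ}
    (h₀ : ∀ k : ℕ, N ≤ k → 0 ≤ p.eval (k : ℚ))
    (h : ∀ k : ℕ, N ≤ k → p.eval (k : ℚ) ≤ q.eval (k : ℚ)) : p.natDegree ≤ q.natDegree := by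
  by_contra! hlt
  have hp : 0 ≤ p.leadingCoeff := leadingCoeff_nonneg_of_eval_natCast_nonneg h₀
  have hqp : 0 ≤ (q - p).coeff p.natDegree :=
    coeff_nonneg_of_eval_natCast_nonneg ((natDegree_sub_le _ _).trans (max_le hlt.le le_rfl))
      fun k hk => by simpa using h k hk
  rw [coeff_sub, coeff_eq_zero_of_natDegree_lt hlt, zero_sub, coeff_natDegree] at hqp
  have : p = 0 := leadingCoeff_eq_zero.1 (by linarith)
  simp [this] at hlt

lemma Polynomial.le_factorial_mul_coeff {h : ℚ[X]} {n r c N : ℕ} (hn : h.natDegree ≤ n)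
    (hr : ∀ k : ℕ, N ≤ k → ((r * (k + n).choose n : ℕ) : ℚ) ≤ h.eval ((k + c : ℕ) : ℚ)) :
    (r : ℚ) ≤ n.factorial * h.coeff n := by
  have hfac : (0 : ℚ) < n.factorial := by exact_mod_cast n.factorial_pos
  let g : ℚ[X] := Polynomial.C ((r : ℚ) / n.factorial) * (Polynomial.X - Polynomial.C (c : ℚ)) ^ n
  have hXc : ((Polynomial.X - Polynomial.C (c : ℚ)) ^ n).natDegree = n := by
    rw [natDegree_pow, natDegree_X_sub_C, mul_one]
  have hg : g.natDegree ≤ n := (natDegree_C_mul_le _ _).trans hXc.le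
  have hgc : g.coeff n = (r : ℚ) / n.factorial := by
    have := ((monic_X_sub_C (c : ℚ)).pow n).coeff_natDegree
    rw [hXc] at this
    rw [Polynomial.coeff_C_mul, this, mul_one]
  have key : 0 ≤ (h - g).coeff n := by
    refine coeff_nonneg_of_eval_natCast_nonneg (N := N + c)
      ((natDegree_sub_le _ _).trans (max_le hn hg)) fun k hk => ?_
    obtain ⟨j, rfl⟩ := Nat.exists_eq_add_of_le' (show c ≤ k by omega)
    have h1 := hr j (by omega)
    have h2 : ((j + n + 1 - n : ℕ) : ℚ) ^ n / n.factorial ≤ (j + n).choose n :=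
      Nat.pow_le_choose n (j + n)
    have h3 : (j : ℚ) ^ n ≤ ((j + n + 1 - n : ℕ) : ℚ) ^ n := by
      gcongr
      omega
    have h4 : (j : ℚ) ^ n / n.factorial ≤ (j + n).choose n := le_trans (by gcongr) h2
    rw [eval_sub, sub_nonneg]
    refine le_trans ?_ h1
    have : g.eval ((j + c : ℕ) : ℚ) = r * ((j : ℚ) ^ n / n.factorial) := by
      simp only [g, eval_mul, eval_pow, eval_sub, Polynomial.eval_X, Polynomial.eval_C]
      push_cast
      ring
    rw [this]
    push_cast
    gcongr
  rw [coeff_sub, hgc, sub_nonneg, div_le_iff₀ hfac] at key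
  linarith

end HilbertPolynomials

/-- A holonomic left `D_n`-module has finite length, and its
length is at most its multiplicity. -/
theorem length_le_mult_of_holonomic
    (K : Type) [Field K] [CharZero K] (n : ℕ)
    (M : Type) [AddCommGroup M] [Module K M] [Module (Weyl K n) M]
    [IsScalarTower K (Weyl K n) M] (hM : IsHolonomic K n M) :
    ∃ ℓ : ℕ, mlength (Weyl K n) M = ℓ ∧
      ∀ m : ℚ, HasMult K n M m → (ℓ : ℚ) ≤ m := by
  obtain ⟨F, hF, h, ⟨N, hN⟩, hdeg⟩ : ∃ F : ℤ → Submodule K M, GoodFiltration K n M F ∧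
      ∃ h : Polynomial ℚ,
        (∃ N : ℤ, ∀ k ≥ N, (Module.finrank K (F k) : ℚ) = h.eval (k : ℚ)) ∧
        h.natDegree ≤ n := by
    rcases hM with hM | ⟨F, hF, h, hh, hn⟩
    · refine ⟨fun _ => ⊥, ⟨fun _ => le_rfl, fun m => ⟨0, ?_⟩, fun _ _ _ _ _ _ => ?_,
        ⟨0, fun _ _ => rfl⟩, fun _ => inferInstance, ⟨0, fun _ _ _ _ => bot_le⟩⟩, 0, ⟨0, ?_⟩, ?_⟩
      · simpa using Subsingleton.elim m 0
      · simpa using Subsingleton.elim _ _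
      · simp
      · simp
    · exact ⟨F, hF, h, hh, hn.le⟩
  have bound : ∀ (s : LTSeries (Submodule (Weyl K n) M)) (F' : ℤ → Submodule K M) (h' : ℚ[X])
      (N' : ℤ), GoodFiltration K n M F' →
      (∀ k ≥ N', (Module.finrank K (F' k) : ℚ) = h'.eval (k : ℚ)) → h'.natDegree ≤ n →
      (s.length : ℚ) ≤ n.factorial * h'.coeff n := by
    intro s F' h' N' hF' hN' hn
    obtain ⟨c, hc⟩ := hF'.exists_length_mul_choose_le s
    refine Polynomial.le_factorial_mul_coeff (c := c) (N := N'.toNat) hn fun k hk => ?_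
    have := hN' (k + c : ℕ) (by push_cast; omega)
    rw [Int.cast_natCast] at this
    rw [← this]
    exact_mod_cast hc k
  obtain ⟨B, hB⟩ := exists_nat_gt (n.factorial * h.coeff n)
  have hlt : Order.krullDim (Submodule (Weyl K n) M) < B := by
    by_contra! hle
    obtain ⟨s, hs⟩ := Order.le_krullDim_iff.1 hle
    have := bound s F h N hF hN hdeg
    rw [hs] at this
    exact this.not_gt hB
  obtain ⟨ℓ, hℓ⟩ : ∃ ℓ : ℕ, Order.krullDim (Submodule (Weyl K n) M) = ℓ := by
    generalize hd : Order.krullDim (Submodule (Weyl K n) M) = d at hlt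
    have hbot : d ≠ ⊥ :=
      hd ▸ ne_bot_of_le_ne_bot WithBot.coe_ne_bot Order.krullDim_nonneg
    lift d to ℕ∞ using hbot
    have htop : d ≠ ⊤ := by
      rintro rfl
      exact not_top_lt hlt
    lift d to ℕ using htop
    exact ⟨d, rfl⟩
  refine ⟨ℓ, hℓ, ?_⟩
  obtain ⟨s, hs⟩ := Order.le_krullDim_iff.1 hℓ.ge
  rintro m ⟨F', hF', h', ⟨N', hN'⟩, rfl⟩
  have heval : ∀ k : ℕ, N'.toNat ≤ k → (Module.finrank K (F' k) : ℚ) = h'.eval (k : ℚ) := by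
    intro k hk
    simpa using hN' k (by omega)
  have h0 : ∀ k : ℕ, N'.toNat ≤ k → 0 ≤ h'.eval (k : ℚ) := fun k hk => heval k hk ▸ by positivity
  have hdeg' : h'.natDegree ≤ n := by
    obtain ⟨c, N₁, hc⟩ := hF.exists_le_shift hF'
    have := hF.finiteDim
    refine le_trans (Polynomial.natDegree_le_of_eval_natCast_le
      (q := h.comp (Polynomial.X + Polynomial.C (c : ℚ)))
      (N := N'.toNat + N₁.toNat + (N - c).toNat) (fun k hk => h0 k (by omega)) fun k hk => ?_) ?_
    · rw [← heval k (by omega), eval_comp, Polynomial.eval_add, Polynomial.eval_X, Polynomial.eval_C]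
      have := hN (k + c) (by omega)
      push_cast at this
      rw [← this]
      exact_mod_cast Submodule.finrank_mono (hc k (by omega))
    · rwa [natDegree_comp, natDegree_X_add_C, mul_one]
  have hℓ' := bound s F' h' N' hF' hN' hdeg'
  rw [hs] at hℓ'
  rcases hdeg'.lt_or_eq with hlt' | heq
  · rw [Polynomial.coeff_eq_zero_of_natDegree_lt hlt', mul_zero] at hℓ'
    exact hℓ'.trans (mul_nonneg (by positivity)
      (Polynomial.leadingCoeff_nonneg_of_eval_natCast_nonneg h0))
  · rwa [← heq] at hℓ'
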